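/- arXiv:1606.08934 — 2 statements merged into one kernel-verified Lean document; each statement's English description precedes it below -/
import Mathlib

section
/- Let n be a natural number and let f : ℝⁿ → ℝ (with ℝⁿ = EuclideanSpace ℝ (Fin n)) be an infinitely differentiable harmonic function such that ∫_{ℝⁿ} f(x)² dx < ∞. Then the derivative of f vanishes identically, i.e. ∇f(x) = 0 for every x ∈ ℝⁿ (so f is constant). -/
open MeasureTheory

lemma cacc_aux (n : ℕ) (f w : EuclideanSpace ℝ (Fin n) → ℝ)
    (hf : ContDiff ℝ (⊤ : ℕ∞) f) (hw : ContDiff ℝ (⊤ : ℕ∞) w) (hc : HasCompactSupport w)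
    (v : EuclideanSpace ℝ (Fin n)) :
    (∫ x, (w x)^2 * (fderiv ℝ f x v)^2) ≤ 4 * (∫ x, (fderiv ℝ w x v)^2 * (f x)^2)
      - 2 * ∫ x, (w x)^2 * f x * fderiv ℝ (fun y => fderiv ℝ f y v) x v := by
  have hg : ContDiff ℝ (⊤ : ℕ∞) (fun y => fderiv ℝ f y v) :=
    (hf.fderiv_right (m := (⊤ : ℕ∞)) (by simp)).clm_apply contDiff_const
  have hg' : ContDiff ℝ (⊤ : ℕ∞) (fun y => fderiv ℝ (fun y => fderiv ℝ f y v) y v) :=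
    (hg.fderiv_right (m := (⊤ : ℕ∞)) (by simp)).clm_apply contDiff_const
  have hw' : ContDiff ℝ (⊤ : ℕ∞) (fun y => fderiv ℝ w y v) :=
    (hw.fderiv_right (m := (⊤ : ℕ∞)) (by simp)).clm_apply contDiff_const
  have cf := hf.continuous
  have cw := hw.continuous
  have cg := hg.continuous
  have cg' := hg'.continuous
  have cw' := hw'.continuous
  have hcw' : HasCompactSupport (fun y => fderiv ℝ w y v) := hc.fderiv_apply (𝕜 := ℝ) v
  have int : ∀ h : EuclideanSpace ℝ (Fin n) → ℝ, Continuous h →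
      Integrable (fun x => w x * h x) := fun h hh =>
    (cw.mul hh).integrable_of_hasCompactSupport hc.mul_right
  have int' : ∀ h : EuclideanSpace ℝ (Fin n) → ℝ, Continuous h →
      Integrable (fun x => fderiv ℝ w x v * h x) := fun h hh =>
    (cw'.mul hh).integrable_of_hasCompactSupport hcw'.mul_right
  have hd : ∀ x, fderiv ℝ (fun x => (w x)^2 * f x) x v =
      2 * w x * fderiv ℝ w x v * f x + (w x)^2 * fderiv ℝ f x v := by
    intro x
    have h1 := (hw.differentiable (by simp) x).hasFDerivAt
    have h2 := (hf.differentiable (by simp) x).hasFDerivAt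
    have h3 : HasFDerivAt (fun x => (w x)^2 * f x) _ x := (h1.pow 2).mul h2
    rw [h3.fderiv]
    simp
    ring
  have A : Integrable (fun x => (w x)^2 * (fderiv ℝ f x v)^2) := by
    refine (int (fun x => w x * (fderiv ℝ f x v)^2) (by fun_prop)).congr (ae_of_all _ fun x => ?_)
    simp only []; ring
  have B : Integrable (fun x => w x * fderiv ℝ w x v * f x * fderiv ℝ f x v) := by
    refine (int (fun x => fderiv ℝ w x v * f x * fderiv ℝ f x v) (by fun_prop)).congr
      (ae_of_all _ fun x => ?_)
    simp only []; ring
  have C : Integrable (fun x => (fderiv ℝ w x v)^2 * (f x)^2) := by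
    refine (int' (fun x => fderiv ℝ w x v * (f x)^2) (by fun_prop)).congr
      (ae_of_all _ fun x => ?_)
    simp only []; ring
  have D : Integrable (fun x => (w x)^2 * f x * fderiv ℝ (fun y => fderiv ℝ f y v) x v) := by
    refine (int (fun x => w x * f x * fderiv ℝ (fun y => fderiv ℝ f y v) x v) (by fun_prop)).congr
      (ae_of_all _ fun x => ?_)
    simp only []; ring
  have key := integral_mul_fderiv_eq_neg_fderiv_mul_of_integrable (μ := volume)
    (f := fun x => (w x)^2 * f x) (g := fun y => fderiv ℝ f y v) (v := v)
    (by
      refine ((B.const_mul 2).add A).congr (ae_of_all _ fun x => ?_)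
      simp only [hd, Pi.add_apply]; ring) D
    (by
      refine (int (fun x => w x * f x * fderiv ℝ f x v) (by fun_prop)).congr
        (ae_of_all _ fun x => ?_)
      simp only []; ring)
    (fun x _ => ((hw.pow 2).mul hf).differentiable (by simp) x)
    (fun x _ => hg.differentiable (by simp) x)
  have e : ∫ x, fderiv ℝ (fun x => (w x)^2 * f x) x v * fderiv ℝ f x v =
      2 * (∫ x, w x * fderiv ℝ w x v * f x * fderiv ℝ f x v) +
        ∫ x, (w x)^2 * (fderiv ℝ f x v)^2 := by
    rw [← integral_const_mul, ← integral_add (B.const_mul 2) A]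
    congr 1; ext x; rw [hd]; ring
  rw [e] at key
  have ineq : 0 ≤ (∫ x, (w x)^2 * (fderiv ℝ f x v)^2)
      + 4 * (∫ x, w x * fderiv ℝ w x v * f x * fderiv ℝ f x v)
      + 4 * ∫ x, (fderiv ℝ w x v)^2 * (f x)^2 := by
    have AB : Integrable (fun x => (w x)^2 * (fderiv ℝ f x v)^2 +
        4 * (w x * fderiv ℝ w x v * f x * fderiv ℝ f x v)) := A.add (B.const_mul 4)
    rw [← integral_const_mul, ← integral_const_mul, ← integral_add A (B.const_mul 4),
      ← integral_add AB (C.const_mul 4)]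
    refine integral_nonneg fun x => ?_
    have := sq_nonneg (w x * fderiv ℝ f x v + 2 * (fderiv ℝ w x v * f x))
    simp only [Pi.zero_apply]
    nlinarith [this]
  linarith

/-- A smooth square-integrable harmonic function on Euclidean space has vanishing gradient. -/
theorem gradient_eq_zero_of_harmonic_L2 (n : ℕ)
    (f : EuclideanSpace ℝ (Fin n) → ℝ)
    (hf : ContDiff ℝ (⊤ : ℕ∞) f)
    (hharm : ∀ x : EuclideanSpace ℝ (Fin n),
      ∑ i : Fin n,
        fderiv ℝ (fun y => fderiv ℝ f y (EuclideanSpace.single i 1)) x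
          (EuclideanSpace.single i 1) = 0)
    (hL2 : Integrable (fun x => (f x) ^ 2)
      (volume : Measure (EuclideanSpace ℝ (Fin n)))) :
    ∀ x : EuclideanSpace ℝ (Fin n), gradient f x = 0 := by
  have hg : ∀ v, ContDiff ℝ (⊤ : ℕ∞) (fun y => fderiv ℝ f y v) := fun v =>
    (hf.fderiv_right (m := (⊤ : ℕ∞)) (by simp)).clm_apply contDiff_const
  have hg' : ∀ v, ContDiff ℝ (⊤ : ℕ∞) (fun y => fderiv ℝ (fun y => fderiv ℝ f y v) y v) :=
    fun v => ((hg v).fderiv_right (m := (⊤ : ℕ∞)) (by simp)).clm_apply contDiff_const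
  let φ : ContDiffBump (0 : EuclideanSpace ℝ (Fin n)) := ⟨1, 2, by norm_num, by norm_num⟩
  have hφ : ContDiff ℝ (⊤ : ℕ∞) φ := φ.contDiff
  obtain ⟨K, hK⟩ : ∃ K, ∀ x, ‖fderiv ℝ φ x‖ ≤ K :=
    (φ.hasCompactSupport.fderiv (𝕜 := ℝ)).exists_bound_of_continuous
      (hφ.continuous_fderiv (by simp))
  have hK0 : 0 ≤ K := (norm_nonneg _).trans (hK 0)
  let w : ℝ → EuclideanSpace ℝ (Fin n) → ℝ := fun l x => φ (l⁻¹ • x)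
  have hw : ∀ l, ContDiff ℝ (⊤ : ℕ∞) (w l) := fun l => hφ.comp (contDiff_const_smul _)
  have hcw : ∀ l, 0 < l → HasCompactSupport (w l) := fun l hl =>
    φ.hasCompactSupport.comp_smul (inv_ne_zero hl.ne')
  have hdw : ∀ l, 0 < l → ∀ i x, (fderiv ℝ (w l) x (EuclideanSpace.single i 1))^2
      ≤ (K / l)^2 := by
    intro l hl i x
    rw [← sq_abs]
    gcongr
    have : fderiv ℝ (w l) x = l⁻¹ • fderiv ℝ φ (l⁻¹ • x) := fderiv_comp_smul _
    rw [← Real.norm_eq_abs, this]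
    refine (ContinuousLinearMap.le_opNorm _ _).trans ?_
    rw [norm_smul, Real.norm_of_nonneg (by positivity)]
    simp only [EuclideanSpace.norm_single, norm_one, mul_one]
    rw [div_eq_inv_mul]
    gcongr
    exact hK _
  have bound : ∀ l, 0 < l → ∀ i, (∫ x, (w l x)^2 * (fderiv ℝ f x (EuclideanSpace.single i 1))^2)
      ≤ (n * (4 * (K^2 * ∫ x, (f x)^2))) / l^2 := by
    intro l hl i
    have h1 : (∫ x, (w l x)^2 * (fderiv ℝ f x (EuclideanSpace.single i 1))^2) ≤
        ∑ i, ∫ x, (w l x)^2 * (fderiv ℝ f x (EuclideanSpace.single i 1))^2 :=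
      Finset.single_le_sum
        (f := fun i => ∫ x, (w l x)^2 * (fderiv ℝ f x (EuclideanSpace.single i 1))^2)
        (fun j _ => integral_nonneg fun x => by positivity) (Finset.mem_univ i)
    have h2 := Finset.sum_le_sum fun i (_ : i ∈ (Finset.univ : Finset (Fin n))) =>
      cacc_aux n f (w l) hf (hw l) (hcw l hl) (EuclideanSpace.single i 1)
    rw [Finset.sum_sub_distrib, ← Finset.mul_sum (a := (2:ℝ)),
      ← integral_finsetSum (f := fun i x => (w l x)^2 * f x * fderiv ℝ
        (fun y => fderiv ℝ f y (EuclideanSpace.single i 1)) x (EuclideanSpace.single i 1))] at h2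
    · have h3 : ∀ x, ∑ i, (w l x)^2 * f x * fderiv ℝ
          (fun y => fderiv ℝ f y (EuclideanSpace.single i 1)) x (EuclideanSpace.single i 1) = 0 := by
        intro x
        rw [← Finset.mul_sum, hharm, mul_zero]
      simp only [h3, integral_zero, mul_zero, sub_zero] at h2
      refine h1.trans (h2.trans ?_)
      have h4 : ∀ i ∈ (Finset.univ : Finset (Fin n)), 4 * (∫ x, (fderiv ℝ (w l) x (EuclideanSpace.single i 1))^2 * (f x)^2)
          ≤ 4 * ((K/l)^2 * ∫ x, (f x)^2) := by
        intro i _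
        gcongr
        rw [← integral_const_mul]
        refine integral_mono_of_nonneg (ae_of_all _ fun x => by positivity) (hL2.const_mul _)
          (ae_of_all _ fun x => ?_)
        exact mul_le_mul_of_nonneg_right (hdw l hl i x) (sq_nonneg _)
      refine (Finset.sum_le_sum h4).trans (le_of_eq ?_)
      simp
      field_simp
    · intro i _
      have c1 := (hw l).continuous
      have c2 := hf.continuous
      have c3 := (hg' (EuclideanSpace.single i 1)).continuous
      refine (Continuous.integrable_of_hasCompactSupport
        (f := fun x => w l x * (w l x * f x * fderiv ℝ
          (fun y => fderiv ℝ f y (EuclideanSpace.single i 1)) x (EuclideanSpace.single i 1)))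
        (by fun_prop) (hcw l hl).mul_right).congr (ae_of_all _ fun x => ?_)
      simp only []; ring
  have one : ∀ l, 0 < l → ∀ x, ‖x‖ ≤ l → w l x = 1 := by
    intro l hl x hx
    apply φ.one_of_mem_closedBall
    simp only [mem_closedBall_zero_iff, norm_smul, norm_inv, Real.norm_of_nonneg hl.le, φ]
    rw [inv_mul_le_iff₀ hl]; simpa using hx
  have zero : ∀ l, 0 < l → ∀ x, 2 * l ≤ ‖x‖ → w l x = 0 := by
    intro l hl x hx
    apply φ.zero_of_le_dist
    simp only [dist_zero_right, norm_smul, norm_inv, Real.norm_of_nonneg hl.le, φ]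
    rw [le_inv_mul_iff₀ hl]; linarith
  have main : ∀ i x, fderiv ℝ f x (EuclideanSpace.single i 1) = 0 := by
    intro i x
    by_contra hx
    have intg : ∀ l, 0 < l →
        HasCompactSupport (fun x => (w l x)^2 * (fderiv ℝ f x (EuclideanSpace.single i 1))^2) ∧
        Continuous (fun x => (w l x)^2 * (fderiv ℝ f x (EuclideanSpace.single i 1))^2) := by
      intro l hl
      have c1 := (hw l).continuous
      have c3 := (hg (EuclideanSpace.single i 1)).continuous
      refine ⟨?_, by fun_prop⟩
      have : HasCompactSupport (fun x => w l x * (w l x * (fderiv ℝ f x (EuclideanSpace.single i 1))^2)) :=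
        (hcw l hl).mul_right
      convert this using 2
      ring
    have hL : 0 < ‖x‖ + 1 := by positivity
    set L := ‖x‖ + 1 with hLdef
    have pos : 0 < ∫ x, (w L x)^2 * (fderiv ℝ f x (EuclideanSpace.single i 1))^2 := by
      refine (intg L hL).2.integral_pos_of_hasCompactSupport_nonneg_nonzero (x := x) (intg L hL).1
        (fun x => by simp only [Pi.zero_apply]; positivity) ?_
      rw [one L hL x (by linarith)]
      simpa using hx
    have le : ∀ l, 2 * L ≤ l → (∫ x, (w L x)^2 * (fderiv ℝ f x (EuclideanSpace.single i 1))^2) ≤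
        (n * (4 * (K^2 * ∫ x, (f x)^2))) / l^2 := by
      intro l hl
      have hl0 : 0 < l := by linarith
      refine le_trans ?_ (bound l hl0 i)
      refine integral_mono ((intg L hL).2.integrable_of_hasCompactSupport (intg L hL).1)
        ((intg l hl0).2.integrable_of_hasCompactSupport (intg l hl0).1) fun y => ?_
      refine mul_le_mul_of_nonneg_right ?_ (sq_nonneg _)
      rcases le_total (2 * L) ‖y‖ with h | h
      · rw [zero L hL y h, zero_pow two_ne_zero]; exact sq_nonneg _
      · rw [one l hl0 y (h.trans hl)]
        have a0 : 0 ≤ w L y := φ.nonneg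
        have a1 : w L y ≤ 1 := φ.le_one
        nlinarith
    have lim : Filter.Tendsto (fun l : ℝ => (n * (4 * (K^2 * ∫ x, (f x)^2))) / l^2)
        Filter.atTop (nhds 0) :=
      tendsto_const_nhds.div_atTop (Filter.tendsto_pow_atTop (by norm_num))
    have := ge_of_tendsto lim ((Filter.eventually_ge_atTop (2 * L)).mono le)
    linarith
  intro x
  have : fderiv ℝ f x = 0 := by
    apply ContinuousLinearMap.coe_injective
    apply (EuclideanSpace.basisFun (Fin n) ℝ).toBasis.ext
    intro i
    simpa using main i x
  simp [gradient, this]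
end

section
/- Let n ≥ 1 be a natural number and let f : ℝⁿ → ℝ (with ℝⁿ = EuclideanSpace ℝ (Fin n)) be an infinitely differentiable harmonic function such that ∫_{ℝⁿ} f(x)² dx < ∞. Then f is identically zero. -/
open MeasureTheory

lemma caccioppoli_aux (n : ℕ)
    (f : EuclideanSpace ℝ (Fin n) → ℝ)
    (hf : ContDiff ℝ (⊤ : ℕ∞) f)
    (hharm : ∀ x : EuclideanSpace ℝ (Fin n),
      ∑ i : Fin n,
        fderiv ℝ (fun y => fderiv ℝ f y (EuclideanSpace.single i 1)) x
          (EuclideanSpace.single i 1) = 0)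
    (η : EuclideanSpace ℝ (Fin n) → ℝ) (hη : ContDiff ℝ (⊤ : ℕ∞) η)
    (hc : HasCompactSupport η) :
    ∑ i : Fin n, ∫ x, (η x * fderiv ℝ f x (EuclideanSpace.single i 1)) ^ 2 ≤
      4 * ∑ i : Fin n, ∫ x, (fderiv ℝ η x (EuclideanSpace.single i 1) * f x) ^ 2 := by
  have hfd : Differentiable ℝ f := hf.differentiable (by simp)
  have hηd : Differentiable ℝ η := hη.differentiable (by simp)
  have hfi : ∀ v, ContDiff ℝ (⊤ : ℕ∞) (fun y => fderiv ℝ f y v) := fun v =>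
    (hf.fderiv_right (m := (⊤ : ℕ∞)) (by simp)).clm_apply contDiff_const
  have hηi : ∀ v, ContDiff ℝ (⊤ : ℕ∞) (fun y => fderiv ℝ η y v) := fun v =>
    (hη.fderiv_right (m := (⊤ : ℕ∞)) (by simp)).clm_apply contDiff_const
  have hfii : ∀ v, Continuous (fun x => fderiv ℝ (fun y => fderiv ℝ f y v) x v) := fun v =>
    (((hfi v).fderiv_right (m := (⊤ : ℕ∞)) (by simp)).clm_apply contDiff_const).continuous
  have hcf := hf.continuous
  have hcη := hη.continuous
  have hcfi := fun v => (hfi v).continuous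
  have hcηi := fun v => (hηi v).continuous
  have hfidd := fun v => (hfi v).differentiable (by simp)
  -- integrability of anything continuous multiplied by eta
  have hI : ∀ g : EuclideanSpace ℝ (Fin n) → ℝ, Continuous g →
      Integrable (fun x => η x * g x) := fun g hg =>
    (hcη.mul hg).integrable_of_hasCompactSupport hc.mul_right
  have hI2 : ∀ v, Integrable (fun x => (fderiv ℝ η x v * f x) ^ 2) := fun v => by
    have h1 : HasCompactSupport (fun x => fderiv ℝ η x v) := by
      exact hc.fderiv_apply (𝕜 := ℝ) v
    have : HasCompactSupport (fun x => fderiv ℝ η x v * (fderiv ℝ η x v * f x ^ 2)) :=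
      h1.mul_right
    have h2 := (((hcηi v).mul ((hcηi v).mul (hcf.pow 2)))).integrable_of_hasCompactSupport (μ := volume) this
    refine h2.congr (Filter.Eventually.of_forall fun x => ?_)
    simp only [Pi.mul_apply, Pi.pow_apply]; ring
  have hder : ∀ v x, fderiv ℝ (fun x => η x * (η x * f x)) x v =
      η x * (2 * fderiv ℝ η x v * f x + η x * fderiv ℝ f x v) := by
    intro v x
    have := ((hηd x).hasFDerivAt.mul ((hηd x).hasFDerivAt.mul (hfd x).hasFDerivAt)).fderiv
    have h2 : fderiv ℝ (fun x => η x * (η x * f x)) x = _ := this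
    rw [h2]
    simp
    ring
  have hibp : ∀ v, ∫ x, η x * (η x * f x * fderiv ℝ (fun y => fderiv ℝ f y v) x v) =
      - ∫ x, η x * ((2 * fderiv ℝ η x v * f x + η x * fderiv ℝ f x v) * fderiv ℝ f x v) := by
    intro v
    have := integral_mul_fderiv_eq_neg_fderiv_mul_of_integrable (μ := volume) (𝕜 := ℝ)
      (f := fun x => η x * (η x * f x)) (g := fun y => fderiv ℝ f y v) (v := v)
      (by
        simp only [hder, mul_assoc]
        refine hI _ ?_
        have := hcfi v; have := hcηi v
        fun_prop)
      (by
        simp only [mul_assoc]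
        refine hI _ ?_
        have := hfii v
        fun_prop)
      (by
        simp only [mul_assoc]
        refine hI _ ?_
        have := hcfi v
        fun_prop)
      (fun x _ => by fun_prop)
      (fun x _ => (hfidd v) x)
    simp only [hder] at this
    simpa only [mul_assoc] using this
  have hsum : ∑ i : Fin n, ∫ x, η x * ((2 * fderiv ℝ η x (EuclideanSpace.single i 1) * f x
      + η x * fderiv ℝ f x (EuclideanSpace.single i 1))
        * fderiv ℝ f x (EuclideanSpace.single i 1)) = 0 := by
    have h0 : ∑ i : Fin n, ∫ x, η x * (η x * f x *
        fderiv ℝ (fun y => fderiv ℝ f y (EuclideanSpace.single i 1)) x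
          (EuclideanSpace.single i 1)) = 0 := by
      rw [← integral_finsetSum]
      · simp only [← Finset.mul_sum, hharm, mul_zero, integral_zero]
      · intro i _
        refine hI _ ?_
        have := hfii (EuclideanSpace.single i 1)
        fun_prop
    simp only [hibp, Finset.sum_neg_distrib] at h0
    linarith
  have hIa : ∀ v, Integrable (fun x => (η x * fderiv ℝ f x v) ^ 2) := fun v => by
    have := hI (fun x => η x * fderiv ℝ f x v ^ 2) (by have := hcfi v; fun_prop)
    refine this.congr (Filter.Eventually.of_forall fun x => ?_)
    simp only; ring
  have hpt : ∀ v, (1/2 : ℝ) * ∫ x, (η x * fderiv ℝ f x v) ^ 2 ≤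
      2 * (∫ x, (fderiv ℝ η x v * f x) ^ 2) +
      ∫ x, η x * ((2 * fderiv ℝ η x v * f x + η x * fderiv ℝ f x v) * fderiv ℝ f x v) := by
    intro v
    have hIb := hI (fun x => (2 * fderiv ℝ η x v * f x + η x * fderiv ℝ f x v) * fderiv ℝ f x v)
      (by have := hcfi v; have := hcηi v; fun_prop)
    rw [← integral_const_mul, ← integral_const_mul, ← integral_add ((hI2 v).const_mul 2) hIb]
    refine integral_mono ((hIa v).const_mul _) (((hI2 v).const_mul 2).add hIb) fun x => ?_
    simp only
    nlinarith [sq_nonneg (η x * fderiv ℝ f x v + 2 * (fderiv ℝ η x v * f x))]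
  have := Finset.sum_le_sum fun (i : Fin n) (_ : i ∈ Finset.univ) =>
    hpt (EuclideanSpace.single i 1)
  rw [Finset.sum_add_distrib, hsum, ← Finset.mul_sum, ← Finset.mul_sum] at this
  linarith

/-- A smooth square-integrable harmonic function on `ℝⁿ`, `n ≥ 1`, is identically zero. -/
theorem harmonic_L2_eq_zero (n : ℕ) (hn : 1 ≤ n)
    (f : EuclideanSpace ℝ (Fin n) → ℝ)
    (hf : ContDiff ℝ (⊤ : ℕ∞) f)
    (hharm : ∀ x : EuclideanSpace ℝ (Fin n),
      ∑ i : Fin n,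
        fderiv ℝ (fun y => fderiv ℝ f y (EuclideanSpace.single i 1)) x
          (EuclideanSpace.single i 1) = 0)
    (hL2 : Integrable (fun x => (f x) ^ 2)
      (volume : Measure (EuclideanSpace ℝ (Fin n)))) :
    ∀ x : EuclideanSpace ℝ (Fin n), f x = 0 := by
  have hcfi : ∀ v, Continuous (fun y => fderiv ℝ f y v) := fun v =>
    ((hf.fderiv_right (m := (⊤ : ℕ∞)) (by simp)).clm_apply contDiff_const).continuous
  -- the derivative vanishes
  have key : ∀ (x₀ : EuclideanSpace ℝ (Fin n)) (i : Fin n),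
      fderiv ℝ f x₀ (EuclideanSpace.single i 1) = 0 := by
    intro x₀ i
    by_contra hne
    let b : ContDiffBump (0 : EuclideanSpace ℝ (Fin n)) := ⟨1, 2, by norm_num, by norm_num⟩
    have hb : ContDiff ℝ (⊤ : ℕ∞) (b : EuclideanSpace ℝ (Fin n) → ℝ) := b.contDiff
    have hbc : HasCompactSupport (b : EuclideanSpace ℝ (Fin n) → ℝ) := b.hasCompactSupport
    obtain ⟨C, hC⟩ := (hbc.fderiv (𝕜 := ℝ)).exists_bound_of_continuous
      (hb.continuous_fderiv (by simp))
    let η : ℝ → EuclideanSpace ℝ (Fin n) → ℝ := fun R x => b (R⁻¹ • (x - x₀))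
    have hη : ∀ R, ContDiff ℝ (⊤ : ℕ∞) (η R) := fun R =>
      hb.comp (by fun_prop)
    have hηc : ∀ R, 0 < R → HasCompactSupport (η R) := by
      intro R hR
      refine HasCompactSupport.intro (isCompact_closedBall x₀ (2 * R)) fun x hx => ?_
      apply b.zero_of_le_dist
      simp only [Metric.mem_closedBall, dist_eq_norm, not_le] at hx
      rw [dist_zero_right, norm_smul, norm_inv, Real.norm_of_nonneg hR.le]
      change 2 ≤ _
      rw [inv_mul_eq_div, le_div_iff₀ hR]
      exact hx.le
    have hηd : ∀ R, 0 < R → ∀ x v, ‖v‖ = 1 → |fderiv ℝ (η R) x v| ≤ R⁻¹ * C := by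
      intro R hR x v hv
      have h1 : HasFDerivAt (fun x : EuclideanSpace ℝ (Fin n) => R⁻¹ • (x - x₀))
          (R⁻¹ • ContinuousLinearMap.id ℝ _) x :=
        ((hasFDerivAt_id x).sub_const x₀).const_smul R⁻¹
      have h2 := ((hb.differentiable (by simp)) (R⁻¹ • (x - x₀))).hasFDerivAt.comp x h1
      have h3 : fderiv ℝ (η R) x = _ := h2.fderiv
      rw [h3]
      simp only [ContinuousLinearMap.comp_apply, smul_apply,
        ContinuousLinearMap.id_apply, map_smul, smul_eq_mul, abs_mul]
      rw [abs_of_pos (inv_pos.2 hR)]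
      gcongr
      have := (fderiv ℝ b (R⁻¹ • (x - x₀))).le_opNorm v
      rw [hv, mul_one] at this
      exact this.trans (hC _)
    have hInt : ∀ R, 0 < R → Integrable
        (fun x => (η R x * fderiv ℝ f x (EuclideanSpace.single i 1)) ^ 2) := by
      intro R hR
      have hcc : HasCompactSupport
          (fun x => η R x * (η R x * fderiv ℝ f x (EuclideanSpace.single i 1) ^ 2)) :=
        (hηc R hR).mul_right
      have := hcfi (EuclideanSpace.single i 1)
      have := (hη R).continuous
      refine (Continuous.integrable_of_hasCompactSupport (by fun_prop) hcc).congr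
        (Filter.Eventually.of_forall fun x => ?_)
      simp only; ring
    have hpos : 0 < ∫ x, (η 1 x * fderiv ℝ f x (EuclideanSpace.single i 1)) ^ 2 := by
      have := hcfi (EuclideanSpace.single i 1)
      have := (hη 1).continuous
      refine integral_pos_of_integrable_nonneg_nonzero (x := x₀) (by fun_prop)
        (hInt 1 one_pos) (fun x => sq_nonneg _) ?_
      have : η 1 x₀ = 1 := by
        apply b.one_of_mem_closedBall
        simp [b.rIn_pos.le]
      rw [this]
      simpa using hne
    have hmono : ∀ R, 2 ≤ R → ∫ x, (η 1 x * fderiv ℝ f x (EuclideanSpace.single i 1)) ^ 2 ≤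
        ∫ x, (η R x * fderiv ℝ f x (EuclideanSpace.single i 1)) ^ 2 := by
      intro R hR
      have hR0 : 0 < R := by linarith
      refine integral_mono (hInt 1 one_pos) (hInt R hR0) fun x => ?_
      simp only [mul_pow]
      refine mul_le_mul_of_nonneg_right ?_ (sq_nonneg _)
      refine pow_le_pow_left₀ b.nonneg ?_ 2
      change η 1 x ≤ η R x
      by_cases hx : ‖x - x₀‖ ≤ R
      · have : η R x = 1 := by
          apply b.one_of_mem_closedBall
          rw [Metric.mem_closedBall, dist_zero_right, norm_smul, norm_inv,
            Real.norm_of_nonneg hR0.le]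
          change _ ≤ (1 : ℝ)
          rw [inv_mul_eq_div, div_le_one hR0]
          exact hx
        rw [this]
        exact b.le_one
      · have : η 1 x = 0 := by
          apply b.zero_of_le_dist
          rw [dist_zero_right]
          change 2 ≤ _
          simp only [inv_one, one_smul]
          linarith
        rw [this]
        exact b.nonneg
    have hbound : ∀ R, 2 ≤ R →
        ∫ x, (η 1 x * fderiv ℝ f x (EuclideanSpace.single i 1)) ^ 2 ≤
          (R⁻¹) ^ 2 * (4 * (n * (C ^ 2 * ∫ x, f x ^ 2))) := by
      intro R hR
      have hR0 : 0 < R := by linarith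
      have h1 := caccioppoli_aux n f hf hharm (η R) (hη R) (hηc R hR0)
      have h2 := Finset.single_le_sum (f := fun i : Fin n =>
        ∫ x, (η R x * fderiv ℝ f x (EuclideanSpace.single i 1)) ^ 2)
        (fun i _ => integral_nonneg fun x => sq_nonneg _) (Finset.mem_univ i)
      have h3 : ∀ j : Fin n, ∫ x, (fderiv ℝ (η R) x (EuclideanSpace.single j 1) * f x) ^ 2 ≤
          (R⁻¹ * C) ^ 2 * ∫ x, f x ^ 2 := by
        intro j
        rw [← integral_const_mul]
        refine integral_mono_of_nonneg (Filter.Eventually.of_forall fun x => sq_nonneg _)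
          (hL2.const_mul _) (Filter.Eventually.of_forall fun x => ?_)
        simp only [mul_pow _ (f x)]
        refine mul_le_mul_of_nonneg_right ?_ (sq_nonneg _)
        rw [← sq_abs]
        exact pow_le_pow_left₀ (abs_nonneg _) (hηd R hR0 x _ (by simp)) 2
      have h4 := Finset.sum_le_sum fun (j : Fin n) (_ : j ∈ Finset.univ) => h3 j
      simp only [Finset.sum_const, Finset.card_univ, Fintype.card_fin, nsmul_eq_mul] at h4
      have h5 := hmono R hR
      calc _ ≤ _ := h5
        _ ≤ _ := h2
        _ ≤ _ := h1
        _ ≤ _ := mul_le_mul_of_nonneg_left h4 (by norm_num)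
        _ = _ := by ring
    have hlim : Filter.Tendsto
        (fun R : ℝ => (R⁻¹) ^ 2 * (4 * (n * (C ^ 2 * ∫ x, f x ^ 2)))) Filter.atTop (nhds 0) := by
      have := (tendsto_inv_atTop_zero (𝕜 := ℝ)).pow 2
      simpa using this.mul_const (4 * (n * (C ^ 2 * ∫ x, f x ^ 2)))
    have := ge_of_tendsto hlim ((Filter.eventually_ge_atTop 2).mono hbound)
    linarith
  have hfd0 : ∀ x, fderiv ℝ f x = 0 := by
    intro x
    have h : (fderiv ℝ f x).toLinearMap = 0 := by
      refine (EuclideanSpace.basisFun (Fin n) ℝ).toBasis.ext fun i => ?_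
      simpa using key x i
    ext v
    exact LinearMap.congr_fun h v
  have hconst : ∀ x y, f x = f y :=
    is_const_of_fderiv_eq_zero (hf.differentiable (by simp)) hfd0
  intro x
  by_contra hx
  have hne : Nonempty (Fin n) := ⟨⟨0, hn⟩⟩
  have hi : Integrable (fun _ : EuclideanSpace ℝ (Fin n) => (f x) ^ 2) := by
    refine hL2.congr (Filter.Eventually.of_forall fun y => ?_)
    simp only [hconst y x]
  rw [integrable_const_iff] at hi
  rcases hi with h | h
  · exact hx (by simpa using h)
  · have : NoncompactSpace (EuclideanSpace ℝ (Fin n)) := NormedSpace.noncompactSpace ℝ _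
    have h1 := measure_univ_of_isAddLeftInvariant
      (volume : Measure (EuclideanSpace ℝ (Fin n)))
    exact absurd h1 (measure_ne_top _ _)
end
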